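/- arXiv:1507.03729 — 4 statements merged into one kernel-verified Lean document; each statement's English description precedes it below -/
import Mathlib

section
/- (Lemma 2) Let N_E ≥ 1 be a natural number, γ̄_B > 0, γ̄_E > 0, and 0 < R_E < R_B. Let γ_B be exponentially distributed with mean γ̄_B and let γ_E be Gamma distributed with shape N_E and scale γ̄_E, with γ_B and γ_E independent. Then the effective secrecy throughput of the fixed-rate transmission scheme, Ψ_f(R_B, R_E) = (R_B − R_E) · P(γ_B ≥ 2^{R_B} − 1) · P(γ_E ≤ 2^{R_E} − 1), equals (R_B − R_E) · e^{−(2^{R_B}−1)/γ̄_B} · (1 − e^{−(2^{R_E}−1)/γ̄_E} · Σ_{j=0}^{N_E−1} (1/j!) · ((2^{R_E}−1)/γ̄_E)^j). -/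
open Real MeasureTheory ProbabilityTheory Finset

namespace ProbabilityTheory

/-- An antiderivative of the density of the Erlang distribution. -/
lemma hasDerivAt_neg_exp_mul_sum_pow_div_factorial (n : ℕ) (r x : ℝ) :
    HasDerivAt
      (fun t ↦ -(Real.exp (-(r * t)) * ∑ j ∈ range (n + 1), (1 / (j.factorial : ℝ)) * (r * t) ^ j))
      (r ^ (n + 1) / n.factorial * x ^ n * Real.exp (-(r * x))) x := by
  have hlin : HasDerivAt (fun t : ℝ ↦ r * t) r x := by
    simpa using (hasDerivAt_id x).const_mul r
  have hexp : HasDerivAt (fun t : ℝ ↦ Real.exp (-(r * t))) (Real.exp (-(r * x)) * -r) x :=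
    hlin.neg.exp
  induction n with
  | zero => simpa [mul_comm] using hexp.fun_neg
  | succ n ih =>
    have hterm := (hexp.mul ((hlin.pow (n + 1)).const_mul (1 / ((n + 1).factorial : ℝ)))).neg
    refine ((ih.add hterm).congr_deriv ?_).congr_of_eventuallyEq (.of_forall fun t ↦ ?_)
    · have : (n.factorial : ℝ) ≠ 0 := by positivity
      have : (n : ℝ) + 1 ≠ 0 := by positivity
      simp only [Nat.factorial_succ, Nat.add_sub_cancel, Pi.pow_apply]
      push_cast
      field_simp
      ring
    · simp only [sum_range_succ _ (n + 1), Pi.add_apply, Pi.mul_apply, Pi.neg_apply, Pi.pow_apply]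
      ring

/-- The CDF of the gamma distribution with a positive integer shape parameter. -/
lemma cdf_gammaMeasure_natCast {n : ℕ} (hn : 1 ≤ n) {r x : ℝ} (hr : 0 < r) (hx : 0 ≤ x) :
    cdf (gammaMeasure n r) x =
      1 - Real.exp (-(r * x)) * ∑ j ∈ range n, (1 / (j.factorial : ℝ)) * (r * x) ^ j := by
  obtain ⟨n, rfl⟩ := Nat.exists_eq_add_of_le' hn
  have hpos : (0 : ℝ) < (n + 1 : ℕ) := by positivity
  have hsupp : ∫ t in Set.Iic x, gammaPDFReal (n + 1 : ℕ) r t =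
      ∫ t in Set.Icc 0 x, gammaPDFReal (n + 1 : ℕ) r t := by
    refine setIntegral_eq_of_subset_of_forall_sdiff_eq_zero measurableSet_Iic
      Set.Icc_subset_Iic_self fun t ht ↦ ?_
    exact if_neg fun h ↦ ht.2 ⟨h, ht.1⟩
  have hdens : ∫ t in Set.Icc 0 x, gammaPDFReal (n + 1 : ℕ) r t =
      ∫ t in Set.Icc 0 x, r ^ (n + 1) / n.factorial * t ^ n * Real.exp (-(r * t)) := by
    refine setIntegral_congr_fun measurableSet_Icc fun t ht ↦ ?_
    simp only [gammaPDFReal, if_pos ht.1]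
    rw [Real.rpow_natCast]
    push_cast
    rw [Real.Gamma_nat_eq_factorial, add_sub_cancel_right, Real.rpow_natCast]
  rw [cdf_gammaMeasure_eq_integral hpos hr, hsupp, hdens, integral_Icc_eq_integral_Ioc,
    ← intervalIntegral.integral_of_le hx,
    intervalIntegral.integral_eq_sub_of_hasDerivAt
      (fun t _ ↦ hasDerivAt_neg_exp_mul_sum_pow_div_factorial n r t)
      (Continuous.intervalIntegrable (by fun_prop) _ _)]
  simp [sum_range_succ']
  ring

/-- The complementary CDF of the exponential distribution. -/
lemma expMeasure_real_Ici {r x : ℝ} (hr : 0 < r) (hx : 0 ≤ x) :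
    (expMeasure r).real (Set.Ici x) = Real.exp (-(r * x)) := by
  have := isProbabilityMeasure_expMeasure hr
  have : NullSingletonClass (expMeasure r) := by
    unfold expMeasure gammaMeasure
    infer_instance
  have hcdf := cdf_expMeasure_eq hr x
  rw [cdf_eq_real, if_pos hx] at hcdf
  rw [← measureReal_congr (Ioi_ae_eq_Ici (μ := expMeasure r)), ← Set.compl_Iic,
    probReal_compl_eq_one_sub measurableSet_Iic, hcdf]
  ring

end ProbabilityTheory

/-- Lemma 2: the effective secrecy throughput of the fixed-rate transmission scheme.
If `γB` is exponentially distributed with mean `γ̄_B` (rate `1/γ̄_B`) and `γE` is Gamma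
distributed with shape `N_E` and scale `γ̄_E` (rate `1/γ̄_E`), independent of `γB`, then
`(R_B − R_E) · P(γB ≥ 2^{R_B} − 1) · P(γE ≤ 2^{R_E} − 1)` equals the stated closed form. -/
theorem est_fixed_rate_scheme
    {Ω : Type*} [MeasureSpace Ω] [IsProbabilityMeasure (ℙ : Measure Ω)]
    (NE : ℕ) (hNE : 1 ≤ NE) (γB γE : ℝ) (hγB : 0 < γB) (hγE : 0 < γE)
    (RB RE : ℝ) (hRE : 0 < RE) (hRERB : RE < RB)
    (X Y : Ω → ℝ) (hX : Measurable X) (hY : Measurable Y)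
    (hmapX : Measure.map X ℙ = expMeasure (1 / γB))
    (hmapY : Measure.map Y ℙ = gammaMeasure (NE : ℝ) (1 / γE))
    (hindep : IndepFun X Y ℙ) :
    (RB - RE) * (ℙ {ω | (2 : ℝ) ^ RB - 1 ≤ X ω}).toReal
        * (ℙ {ω | Y ω ≤ (2 : ℝ) ^ RE - 1}).toReal
      = (RB - RE) * Real.exp (-((2 : ℝ) ^ RB - 1) / γB) *
        (1 - Real.exp (-((2 : ℝ) ^ RE - 1) / γE) *
          ∑ j ∈ range NE, (1 / (Nat.factorial j : ℝ)) *
            (((2 : ℝ) ^ RE - 1) / γE) ^ j) := by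
  have hB : 0 ≤ (2 : ℝ) ^ RB - 1 :=
    sub_nonneg.2 (Real.one_le_rpow one_le_two (hRE.trans hRERB).le)
  have hE : 0 ≤ (2 : ℝ) ^ RE - 1 := sub_nonneg.2 (Real.one_le_rpow one_le_two hRE.le)
  have hPX : (ℙ {ω | (2 : ℝ) ^ RB - 1 ≤ X ω}).toReal =
      Real.exp (-((2 : ℝ) ^ RB - 1) / γB) := by
    have h := expMeasure_real_Ici (one_div_pos.2 hγB) hB
    rw [← hmapX, map_measureReal_apply hX measurableSet_Ici] at h
    refine h.trans ?_
    congr 1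
    ring
  have hPY : (ℙ {ω | Y ω ≤ (2 : ℝ) ^ RE - 1}).toReal =
      1 - Real.exp (-((2 : ℝ) ^ RE - 1) / γE) *
        ∑ j ∈ range NE, (1 / (Nat.factorial j : ℝ)) * (((2 : ℝ) ^ RE - 1) / γE) ^ j := by
    have h := cdf_gammaMeasure_natCast hNE (one_div_pos.2 hγE) hE
    have : IsProbabilityMeasure (Measure.map Y ℙ) :=
      Measure.isProbabilityMeasure_map hY.aemeasurable
    rw [← hmapY, cdf_eq_real, map_measureReal_apply hY measurableSet_Iic,
      one_div_mul_eq_div, ← neg_div] at h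
    exact h
  rw [hPX, hPY]
end

section
/- (Theorem 1) Let N_E ≥ 1 be a natural number, η > 0, c₀ > 0, 0 < ρ_i < ρ_o, C_B > 0 and 0 < R_E < C_B. Set u = (2^{R_E} − 1)/c₀ and, for each j with 0 ≤ j ≤ N_E − 1, set v = j + 2/η. Then (1/(ρ_o² − ρ_i²)) · ∫_{ρ_i²}^{ρ_o²} (C_B − R_E) · (1 − e^{−u·s^{η/2}} · Σ_{j=0}^{N_E−1} (1/j!) · (u·s^{η/2})^j) ds = (C_B − R_E) · (1 − Σ_{j=0}^{N_E−1} (2 u^j / j!) · (γ(v, u ρ_o^η) − γ(v, u ρ_i^η)) / ((ρ_o² − ρ_i²) · η · u^v)), where γ(v, x) = ∫_0^x t^{v−1} e^{−t} dt is the lower incomplete gamma function. -/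
open Real MeasureTheory Finset

/-- The Gamma integrand `t ^ (v - 1) * exp (-t)` is integrable up to any nonnegative endpoint. -/
lemma intervalIntegrable_rpow_mul_exp_neg {v : ℝ} (hv : 0 < v) (x : ℝ) :
    IntervalIntegrable (fun t : ℝ => t ^ (v - 1) * Real.exp (-t)) volume 0 x :=
  (intervalIntegral.intervalIntegrable_rpow' (by linarith)).mul_continuousOn
    (by fun_prop)

/-- The substitution `t = u * s ^ p` in a Gamma-type integral. -/
lemma integral_exp_neg_mul_rpow_mul_pow {u p a b : ℝ} (hu : 0 < u) (hp : 0 < p) (ha : 0 < a)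
    (hb : 0 < b) (j : ℕ) :
    ∫ s in a..b, Real.exp (-(u * s ^ p)) * (u * s ^ p) ^ j =
      (∫ t in (u * a ^ p)..(u * b ^ p), t ^ ((j : ℝ) + 1 / p - 1) * Real.exp (-t)) /
        (p * u ^ (1 / p)) := by
  have hpos : ∀ x ∈ Set.uIcc a b, 0 < x := fun x hx => (lt_min ha hb).trans_le hx.1
  have hderiv : ∀ x ∈ Set.uIcc a b,
      HasDerivAt (fun s : ℝ => u * s ^ p) (u * (p * x ^ (p - 1))) x := fun x hx =>
    (Real.hasDerivAt_rpow_const (Or.inl (hpos x hx).ne')).const_mul u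
  have hcont : ContinuousOn (fun x : ℝ => u * (p * x ^ (p - 1))) (Set.uIcc a b) := by
    refine continuousOn_const.mul (continuousOn_const.mul ?_)
    exact continuousOn_id.rpow_const fun x hx => Or.inl (hpos x hx).ne'
  have hg : ContinuousOn (fun t : ℝ => t ^ ((j : ℝ) + 1 / p - 1) * Real.exp (-t))
      ((fun s : ℝ => u * s ^ p) '' Set.uIcc a b) := by
    refine ContinuousOn.mul ?_ (by fun_prop)
    refine continuousOn_id.rpow_const ?_
    rintro _ ⟨x, hx, rfl⟩
    exact Or.inl (mul_pos hu (Real.rpow_pos_of_pos (hpos x hx) p)).ne'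
  have key := intervalIntegral.integral_comp_mul_deriv' hderiv hcont hg
  have hup : 0 < u ^ (1 / p) := Real.rpow_pos_of_pos hu _
  rw [← key, eq_div_iff (by positivity), ← intervalIntegral.integral_mul_const]
  refine intervalIntegral.integral_congr fun x hx => ?_
  have hx0 := hpos x hx
  have hxp : 0 < x ^ p := Real.rpow_pos_of_pos hx0 p
  have hroot : (u * x ^ p) ^ (1 / p) = u ^ (1 / p) * x := by
    rw [Real.mul_rpow hu.le hxp.le, ← Real.rpow_mul hx0.le, mul_one_div_cancel hp.ne',
      Real.rpow_one]
  simp only [Function.comp_apply]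
  rw [Real.rpow_sub_one (by positivity), Real.rpow_add (by positivity), Real.rpow_natCast, hroot,
    Real.rpow_sub_one hx0.ne']
  field_simp

/-- Theorem 1: the average effective secrecy throughput of the adaptive transmission
scheme under the annulus threat model, expressed via the lower incomplete gamma
function `γinc v x = ∫_0^x t^{v−1} e^{−t} dt`. -/
theorem avg_est_adaptive_annulus
    (NE : ℕ) (hNE : 1 ≤ NE) (η c0 ρi ρo CB RE : ℝ)
    (hη : 0 < η) (hc0 : 0 < c0) (hρi : 0 < ρi) (hρ : ρi < ρo)
    (hCB : 0 < CB) (hRE : 0 < RE) (hRECB : RE < CB)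
    (u : ℝ) (hu : u = ((2 : ℝ) ^ RE - 1) / c0)
    (γinc : ℝ → ℝ → ℝ)
    (hγinc : ∀ v x, γinc v x = ∫ t in (0:ℝ)..x, t ^ (v - 1) * Real.exp (-t)) :
    (1 / (ρo ^ 2 - ρi ^ 2)) *
      ∫ s in (ρi ^ 2)..(ρo ^ 2),
        (CB - RE) * (1 - Real.exp (-(u * s ^ (η / 2))) *
          ∑ j ∈ range NE, (1 / (Nat.factorial j : ℝ)) * (u * s ^ (η / 2)) ^ j)
    = (CB - RE) *
        (1 - ∑ j ∈ range NE, (2 * u ^ j / (Nat.factorial j : ℝ)) *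
          ((γinc ((j : ℝ) + 2 / η) (u * ρo ^ η) - γinc ((j : ℝ) + 2 / η) (u * ρi ^ η)) /
            ((ρo ^ 2 - ρi ^ 2) * η * u ^ ((j : ℝ) + 2 / η)))) := by
  have hρo : 0 < ρo := hρi.trans hρ
  have hu0 : 0 < u := by
    rw [hu]
    exact div_pos (sub_pos.2 (Real.one_lt_rpow (by norm_num) hRE)) hc0
  have hD : 0 < ρo ^ 2 - ρi ^ 2 := by nlinarith
  have hpow : ∀ ρ : ℝ, 0 < ρ → (ρ ^ 2) ^ (η / 2) = ρ ^ η := fun ρ h => by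
    rw [← Real.rpow_natCast, ← Real.rpow_mul h.le]
    congr 1
    push_cast
    ring
  have hcont : Continuous fun s : ℝ => s ^ (η / 2) :=
    Real.continuous_rpow_const (by positivity)
  have hterm : ∀ j : ℕ,
      ∫ s in (ρi ^ 2)..(ρo ^ 2), Real.exp (-(u * s ^ (η / 2))) * (u * s ^ (η / 2)) ^ j =
        (γinc ((j : ℝ) + 2 / η) (u * ρo ^ η) - γinc ((j : ℝ) + 2 / η) (u * ρi ^ η)) /
          (η / 2 * u ^ (2 / η)) := fun j => by
    have hv : 0 < (j : ℝ) + 2 / η := by positivity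
    rw [integral_exp_neg_mul_rpow_mul_pow hu0 (by positivity) (by positivity) (by positivity),
      hpow _ hρo, hpow _ hρi, one_div_div, hγinc, hγinc,
      intervalIntegral.integral_interval_sub_left (intervalIntegrable_rpow_mul_exp_neg hv _)
        (intervalIntegrable_rpow_mul_exp_neg hv _)]
  have hsum : ∫ s in (ρi ^ 2)..(ρo ^ 2), Real.exp (-(u * s ^ (η / 2))) *
        ∑ j ∈ range NE, (1 / (Nat.factorial j : ℝ)) * (u * s ^ (η / 2)) ^ j =
      ∑ j ∈ range NE, (1 / (Nat.factorial j : ℝ)) *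
        ((γinc ((j : ℝ) + 2 / η) (u * ρo ^ η) - γinc ((j : ℝ) + 2 / η) (u * ρi ^ η)) /
          (η / 2 * u ^ (2 / η))) := by
    simp_rw [Finset.mul_sum, mul_left_comm (Real.exp _)]
    rw [intervalIntegral.integral_finsetSum fun j _ =>
      Continuous.intervalIntegrable (by fun_prop) _ _]
    simp_rw [intervalIntegral.integral_const_mul, hterm]
  rw [intervalIntegral.integral_const_mul, intervalIntegral.integral_sub (by simp)
    (Continuous.intervalIntegrable (by fun_prop) _ _), hsum, intervalIntegral.integral_const,
    smul_eq_mul, mul_one, mul_left_comm, mul_sub, one_div_mul_cancel hD.ne', Finset.mul_sum]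
  congr 2
  refine Finset.sum_congr rfl fun j _ => ?_
  have hup : 0 < u ^ (2 / η) := Real.rpow_pos_of_pos hu0 _
  rw [Real.rpow_add hu0, Real.rpow_natCast]
  field_simp
end

section
/- Let N_E ≥ 1 be a natural number, γ̄_E > 0 and C_B > 0. The function Ψ_a(R) = (C_B − R)(1 − e^{−(2^R−1)/γ̄_E} Σ_{j=0}^{N_E−1} (1/j!)((2^R−1)/γ̄_E)^j) is twice differentiable at every R > 0, with second derivative Ψ_a''(R) = (2^R ln 2/γ̄_E) · (e^{−(2^R−1)/γ̄_E}/(N_E−1)!) · ((2^R−1)/γ̄_E)^{N_E−1} · [ (C_B − R)(1 − 2^R/γ̄_E) ln 2 − 2 + (ln 2/(2^R − 1) + ln 2)(C_B − R)(N_E − 1) ]. -/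
open Real Finset

/-- The derivative of the Erlang distribution function
`x ↦ 1 - exp (-x) * ∑ j ≤ n, x ^ j / j!`. -/
theorem hasDerivAt_erlang_cdf (n : ℕ) (x : ℝ) :
    HasDerivAt
      (fun x : ℝ => 1 - Real.exp (-x) *
        ∑ j ∈ range (n + 1), (1 / (Nat.factorial j : ℝ)) * x ^ j)
      (Real.exp (-x) / (Nat.factorial n : ℝ) * x ^ n) x := by
  have hexp : HasDerivAt (fun x : ℝ => Real.exp (-x)) (-Real.exp (-x)) x := by
    simpa using (hasDerivAt_neg x).exp
  induction n with
  | zero => simpa using hexp.const_sub 1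
  | succ n ih =>
    have hterm := hexp.mul ((hasDerivAt_pow (n + 1) x).const_mul
      (1 / (Nat.factorial (n + 1) : ℝ)))
    refine ((ih.sub hterm).congr_of_eventuallyEq (.of_eq (funext fun y => ?_))).congr_deriv ?_
    · rw [sum_range_succ _ (n + 1)]
      simp only [Pi.sub_apply, Pi.mul_apply]
      ring
    · have hn : (n : ℝ) + 1 ≠ 0 := by positivity
      rw [Nat.factorial_succ]
      push_cast
      field_simp
      ring

theorem hasDerivAt_two_rpow_sub_one_div (γ r : ℝ) :
    HasDerivAt (fun r : ℝ => ((2 : ℝ) ^ r - 1) / γ) ((2 : ℝ) ^ r * Real.log 2 / γ) r :=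
  ((Real.hasStrictDerivAt_const_rpow two_pos r).hasDerivAt.sub_const 1).div_const γ

/-- Eq. (12): the EST of the adaptive transmission scheme is twice differentiable in the
redundancy rate `R > 0`, with the stated second derivative. -/
theorem est_adaptive_second_deriv
    (NE : ℕ) (hNE : 1 ≤ NE) (γE CB : ℝ) (hγE : 0 < γE) (hCB : 0 < CB)
    (R : ℝ) (hR : 0 < R) :
    DifferentiableAt ℝ
      (fun r : ℝ => (CB - r) *
        (1 - Real.exp (-((2 : ℝ) ^ r - 1) / γE) *
          ∑ j ∈ range NE, (1 / (Nat.factorial j : ℝ)) * (((2 : ℝ) ^ r - 1) / γE) ^ j)) R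
    ∧ HasDerivAt
      (deriv (fun r : ℝ => (CB - r) *
        (1 - Real.exp (-((2 : ℝ) ^ r - 1) / γE) *
          ∑ j ∈ range NE, (1 / (Nat.factorial j : ℝ)) * (((2 : ℝ) ^ r - 1) / γE) ^ j)))
      (((2 : ℝ) ^ R * Real.log 2 / γE) *
        (Real.exp (-((2 : ℝ) ^ R - 1) / γE) / (Nat.factorial (NE - 1) : ℝ)) *
        (((2 : ℝ) ^ R - 1) / γE) ^ (NE - 1) *
        ((CB - R) * (1 - (2 : ℝ) ^ R / γE) * Real.log 2 - 2
          + (Real.log 2 / ((2 : ℝ) ^ R - 1) + Real.log 2) * (CB - R) * ((NE : ℝ) - 1))) R := by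
  obtain ⟨n, rfl⟩ : ∃ n, NE = n + 1 := ⟨NE - 1, by omega⟩
  have hx := hasDerivAt_two_rpow_sub_one_div γE
  have hF (r : ℝ) := (hasDerivAt_erlang_cdf n (((2 : ℝ) ^ r - 1) / γE)).comp r (hx r)
  have hC (r : ℝ) : HasDerivAt (fun r : ℝ => CB - r) (-1) r := (hasDerivAt_id r).const_sub CB
  have hΨ (r : ℝ) := (hC r).mul (hF r)
  simp only [neg_div]
  refine ⟨(hΨ R).differentiableAt, ?_⟩
  have hderiv := funext fun r => (hΨ r).deriv
  have hexp : HasDerivAt (fun r : ℝ => Real.exp (-(((2 : ℝ) ^ r - 1) / γE))) _ R :=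
    (hx R).neg.exp
  have hx' : HasDerivAt (fun r : ℝ => (2 : ℝ) ^ r * Real.log 2 / γE) _ R :=
    ((Real.hasStrictDerivAt_const_rpow two_pos R).hasDerivAt.mul_const (Real.log 2)).div_const γE
  have hF' := ((hexp.div_const (Nat.factorial n : ℝ)).mul ((hx R).pow n)).mul hx'
  have hΨ' := ((hF R).const_mul (-1)).add ((hC R).mul hF')
  have hpos : 0 < (2 : ℝ) ^ R - 1 := sub_pos.2 (Real.one_lt_rpow one_lt_two hR)
  refine (hΨ'.congr_of_eventuallyEq (Filter.EventuallyEq.of_eq hderiv)).congr_deriv ?_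
  simp only [Nat.add_sub_cancel, Pi.mul_apply, Pi.pow_apply, Pi.neg_apply]
  generalize Real.exp _ = e
  generalize (2 : ℝ) ^ R = t at hpos ⊢
  cases n with
  | zero =>
    simp
    field_simp
    ring
  | succ m =>
    simp only [Nat.add_sub_cancel, pow_succ]
    push_cast
    field_simp
    ring
end

section
/- Let N_E ≥ 1, γ̄_B > 0, γ̄_E > 0, and fix R_B > 0. Define F(R_E) = Σ_{j=0}^{N_E−1} (1/j!)((2^{R_E}−1)/γ̄_E)^j and G(R_E) = (2^{R_E} ln 2 / (γ̄_E (N_E−1)!)) · ((2^{R_E}−1)/γ̄_E)^{N_E−1}. Then for 0 < R_E < R_B, the partial derivative of Ψ_f(R_B, R_E) = (R_B − R_E) e^{−(2^{R_B}−1)/γ̄_B}(1 − e^{−(2^{R_E}−1)/γ̄_E} F(R_E)) with respect to R_E vanishes if and only if R_B = R_E + (e^{(2^{R_E}−1)/γ̄_E} − F(R_E)) / G(R_E). -/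
open Real Finset

/-- The derivative of `e^{-x} ∑_{j ≤ n} x^j / j!` telescopes to `-e^{-x} x^n / n!`. -/
theorem hasDerivAt_exp_neg_mul_sum_pow_div_factorial (n : ℕ) (x : ℝ) :
    HasDerivAt (fun y : ℝ => Real.exp (-y) *
        ∑ j ∈ range (n + 1), (1 / (Nat.factorial j : ℝ)) * y ^ j)
      (-(Real.exp (-x) * ((1 / (Nat.factorial n : ℝ)) * x ^ n))) x := by
  have hexp : HasDerivAt (fun y : ℝ => Real.exp (-y)) (-Real.exp (-x)) x := by
    simpa using (hasDerivAt_neg x).exp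
  induction n with
  | zero => simpa using hexp
  | succ n ih =>
    have hterm := hexp.mul ((hasDerivAt_pow (n + 1) x).const_mul
      (1 / (Nat.factorial (n + 1) : ℝ)))
    have hsum := ih.add hterm
    refine (hsum.congr_deriv ?_).congr_of_eventuallyEq (.of_forall fun y => ?_)
    rotate_left
    · simp only [Pi.add_apply, Pi.mul_apply]
      rw [sum_range_succ _ (n + 1), mul_add]
    · rw [Nat.factorial_succ]
      push_cast
      field_simp
      ring

/-- Eq. (23): first-order condition of the fixed-rate EST in the redundancy rate `R_E`.
For `0 < R_E < R_B`, the partial derivative of `Ψ_f(R_B, ·)` at `R_E` vanishes iff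
`R_B = R_E + (e^{(2^{R_E}−1)/γ̄_E} − F(R_E))/G(R_E)`. -/
theorem est_fixed_rate_deriv_RE
    (NE : ℕ) (hNE : 1 ≤ NE) (γB γE : ℝ) (hγB : 0 < γB) (hγE : 0 < γE)
    (RB : ℝ) (hRB : 0 < RB)
    (F G : ℝ → ℝ)
    (hF : ∀ r : ℝ, F r = ∑ j ∈ range NE,
      (1 / (Nat.factorial j : ℝ)) * (((2 : ℝ) ^ r - 1) / γE) ^ j)
    (hG : ∀ r : ℝ, G r = ((2 : ℝ) ^ r * Real.log 2 / (γE * (Nat.factorial (NE - 1) : ℝ))) *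
      (((2 : ℝ) ^ r - 1) / γE) ^ (NE - 1)) :
    ∀ RE : ℝ, 0 < RE → RE < RB →
      (deriv (fun r : ℝ => (RB - r) * Real.exp (-((2 : ℝ) ^ RB - 1) / γB) *
          (1 - Real.exp (-((2 : ℝ) ^ r - 1) / γE) * F r)) RE = 0
        ↔ RB = RE + (Real.exp (((2 : ℝ) ^ RE - 1) / γE) - F RE) / G RE) := by
  intro RE hRE _
  obtain ⟨n, rfl⟩ : ∃ n, NE = n + 1 := ⟨NE - 1, by omega⟩
  have hpow : 1 < (2 : ℝ) ^ RE := Real.one_lt_rpow one_lt_two hRE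
  have hx : 0 < ((2 : ℝ) ^ RE - 1) / γE := div_pos (by linarith) hγE
  have hlog : 0 < Real.log 2 := Real.log_pos one_lt_two
  have hGpos : 0 < G RE := by
    rw [hG]
    positivity
  have hsnr : HasDerivAt (fun r : ℝ => ((2 : ℝ) ^ r - 1) / γE)
      ((2 : ℝ) ^ RE * Real.log 2 / γE) RE := by
    have h := (((hasDerivAt_id RE).const_rpow two_pos).sub_const 1).div_const γE
    refine h.congr_deriv ?_
    simp only [id]
    ring
  have hoff : HasDerivAt (fun r : ℝ => Real.exp (-((2 : ℝ) ^ r - 1) / γE) * F r)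
      (-(Real.exp (-(((2 : ℝ) ^ RE - 1) / γE)) * G RE)) RE := by
    have h := (hasDerivAt_exp_neg_mul_sum_pow_div_factorial n
      (((2 : ℝ) ^ RE - 1) / γE)).comp RE hsnr
    refine (h.congr_deriv ?_).congr_of_eventuallyEq (.of_forall fun r => ?_)
    rotate_left
    · simp only [Function.comp_apply, hF, neg_div]
    · rw [hG, Nat.add_sub_cancel]
      field_simp
  have hderiv := (((hasDerivAt_id RE).const_sub RB).mul_const
    (Real.exp (-((2 : ℝ) ^ RB - 1) / γB))).mul (hoff.const_sub 1)
  have hval : deriv (fun r : ℝ => (RB - r) * Real.exp (-((2 : ℝ) ^ RB - 1) / γB) *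
      (1 - Real.exp (-((2 : ℝ) ^ r - 1) / γE) * F r)) RE =
      Real.exp (-((2 : ℝ) ^ RB - 1) / γB) * Real.exp (-(((2 : ℝ) ^ RE - 1) / γE)) *
        ((RB - RE) * G RE - (Real.exp (((2 : ℝ) ^ RE - 1) / γE) - F RE)) := by
    refine hderiv.deriv.trans ?_
    have hinv : Real.exp (-(((2 : ℝ) ^ RE - 1) / γE)) *
        Real.exp (((2 : ℝ) ^ RE - 1) / γE) = 1 := by
      rw [← Real.exp_add, neg_add_cancel, Real.exp_zero]
    simp only [id, neg_div _ ((2 : ℝ) ^ RE - 1)]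
    linear_combination Real.exp (-((2 : ℝ) ^ RB - 1) / γB) * hinv
  rw [hval, mul_eq_zero, or_iff_right (by positivity), sub_eq_zero,
    ← eq_div_iff hGpos.ne', sub_eq_iff_eq_add']
end
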